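/- For every b > 1/2 there exists a constant C > 0, depending only on ν, μ and b, such that for all Schwartz functions u, v on ℝ² one has ‖I^{1/2}(u,v)‖_{L²(ℝ²)} ≤ C ‖u‖_{X_{0,b}} ‖v‖_{X_{0,b}}. (Bilinear refinement estimate, Lemma 2.5.) -/

import Mathlib

open MeasureTheory Real
open scoped ENNReal NNReal Classical

noncomputable section

/-- Phase function of the linear Benjamin equation: `φ(ξ) = -ν ξ|ξ| + μ ξ³`. -/
def phase (ν μ ξ : ℝ) : ℝ := -ν * ξ * |ξ| + μ * ξ ^ 3

/-- Derivative of the phase: `φ'(ξ) = -2ν|ξ| + 3μξ²`. -/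
def dphase (ν μ ξ : ℝ) : ℝ := -2 * ν * |ξ| + 3 * μ * ξ ^ 2

/-- The frequency threshold `a = 2·max(1, |2ν/(3μ)|)`. -/
def aconst (ν μ : ℝ) : ℝ := 2 * max 1 |2 * ν / (3 * μ)|

/-- Fourier transform in the space variable. -/
def FT (f : ℝ → ℂ) (ξ : ℝ) : ℂ := ∫ x : ℝ, Complex.exp (-(Complex.I * ξ * x)) * f x

/-- Space-time Fourier transform. -/
def FT2 (u : ℝ → ℝ → ℂ) (ξ τ : ℝ) : ℂ :=
  ∫ x : ℝ, ∫ t : ℝ, Complex.exp (-(Complex.I * (ξ * x + τ * t))) * u x t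

/-- Mixed norm `‖f‖_{L^p_x L^q_t}` (with exponents in `ℝ≥0∞`). -/
def mixedLpLq (p q : ℝ≥0∞) (f : ℝ → ℝ → ℂ) : ℝ≥0∞ :=
  if p = ∞ then essSup (fun x => eLpNorm (f x) q volume) volume
  else (∫⁻ x : ℝ, eLpNorm (f x) q volume ^ p.toReal) ^ (1 / p.toReal)

/-- The Bourgain norm `‖u‖_{X_{s,b}}` associated to the Benjamin phase function. -/
def XNorm (ν μ s b : ℝ) (u : ℝ → ℝ → ℂ) : ℝ≥0∞ :=
  (∫⁻ ξ : ℝ, ∫⁻ τ : ℝ,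
      ENNReal.ofReal ((1 + ξ ^ 2) ^ s * (1 + (τ - phase ν μ ξ) ^ 2) ^ b) *
        (‖FT2 u ξ τ‖₊ : ℝ≥0∞) ^ 2) ^ (1 / 2 : ℝ)

/-- The free Benjamin group `S(t)` applied to initial data `u₀`, as a function of `(x,t)`. -/
def Sgrp (ν μ : ℝ) (u₀ : ℝ → ℂ) (x t : ℝ) : ℂ :=
  (2 * π)⁻¹ • ∫ ξ : ℝ, Complex.exp (Complex.I * (ξ * x + phase ν μ ξ * t)) * FT u₀ ξ

/-- `D_x^α S(t) P^a u₀` : the Benjamin group composed with the Fourier restriction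
`P^a` to `{|ξ| ≥ a}` and the derivative operator `D_x^α`. -/
def DSgrpPa (ν μ α : ℝ) (u₀ : ℝ → ℂ) (x t : ℝ) : ℂ :=
  (2 * π)⁻¹ • ∫ ξ : ℝ,
    if aconst ν μ ≤ |ξ| then
      (↑(|ξ| ^ α) : ℂ) * Complex.exp (Complex.I * (ξ * x + phase ν μ ξ * t)) * FT u₀ ξ
    else 0

/-- `D_x^α P^a F` acting in the space variable of a space-time function `F`. -/
def DPa (ν μ α : ℝ) (F : ℝ → ℝ → ℂ) (x t : ℝ) : ℂ :=
  (2 * π)⁻¹ • ∫ ξ : ℝ,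
    if aconst ν μ ≤ |ξ| then
      (↑(|ξ| ^ α) : ℂ) * Complex.exp (Complex.I * (ξ * x)) * FT (fun y => F y t) ξ
    else 0

/-- The space-time Fourier transform of the bilinear operator `I^s(u,v)`:
`(I^s(u,v))^(ξ,τ) = ∫ |φ'(ξ₁) - φ'(ξ₂)|^s û(ξ₁,τ₁) v̂(ξ₂,τ₂)` over
`ξ₁ + ξ₂ = ξ`, `τ₁ + τ₂ = τ`. -/
def IsHat (ν μ s : ℝ) (u v : ℝ → ℝ → ℂ) (ξ τ : ℝ) : ℂ :=
  ∫ ξ₁ : ℝ, ∫ τ₁ : ℝ,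
    (↑(|dphase ν μ ξ₁ - dphase ν μ (ξ - ξ₁)| ^ s) : ℂ) *
      (FT2 u ξ₁ τ₁ * FT2 v (ξ - ξ₁) (τ - τ₁))

/-- The bilinear operator `I^s(u,v)`, recovered from its space-time Fourier
transform by the inverse Fourier transform. -/
def IsOp (ν μ s : ℝ) (u v : ℝ → ℝ → ℂ) (x t : ℝ) : ℂ :=
  ((2 * π) ^ 2)⁻¹ • ∫ ξ : ℝ, ∫ τ : ℝ,
    Complex.exp (Complex.I * (ξ * x + τ * t)) * IsHat ν μ s u v ξ τ


open scoped FourierTransform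

theorem eLpNorm_fourier_le {E : Type*} [NormedAddCommGroup E] [InnerProductSpace ℝ E]
    [FiniteDimensional ℝ E] [MeasurableSpace E] [BorelSpace E] {g : E → ℂ} (hg : Integrable g) :
    eLpNorm (𝓕 g) 2 volume ≤ eLpNorm g 2 volume := by
  by_cases htop : eLpNorm g 2 volume = ∞
  · simp [htop]
  have h2 : MemLp g 2 volume := ⟨hg.1, lt_top_iff_ne_top.2 htop⟩
  have hcont : Continuous (𝓕 g) :=
    VectorFourier.fourierIntegral_continuous Real.continuous_fourierChar continuous_inner hg
  have hae : ∀ᵐ x, (𝓕 (h2.toLp g : Lp (α := E) ℂ 2 volume) : Lp (α := E) ℂ 2 volume) x = 𝓕 g x := by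
    apply ae_eq_of_integral_contDiff_smul_eq
    · exact (Lp.memLp _).locallyIntegrable (by norm_num)
    · exact hcont.locallyIntegrable
    · intro φ hφ hφc
      have hφ₁ : HasCompactSupport (Complex.ofRealCLM ∘ φ) := hφc.comp_left rfl
      have hφ₂ : ContDiff ℝ ((⊤ : ℕ∞) : WithTop ℕ∞) (Complex.ofRealCLM ∘ φ) := by fun_prop
      set ψ := hφ₁.toSchwartzMap hφ₂ with hψ
      have e1 := congrArg (fun T => T ψ) (Lp.fourier_toTemperedDistribution_eq (h2.toLp g))
      simp only [TemperedDistribution.fourier_apply, Lp.toTemperedDistribution_apply] at e1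
      have e2 : ∫ x, (𝓕 ψ) x • (h2.toLp g) x = ∫ x, (𝓕 ψ) x • g x := by
        apply integral_congr_ae
        filter_upwards [h2.coeFn_toLp] with x hx
        rw [hx]
      have e3 : ∫ x, (𝓕 ψ) x • g x = ∫ x, ψ x • 𝓕 g x := by
        simpa using! VectorFourier.integral_fourierIntegral_smul_eq_flip (L := innerₗ E)
          Real.continuous_fourierChar continuous_inner ψ.integrable hg
      have e4 := e1.symm.trans (e2.trans e3)
      simpa [hψ] using e4
  rw [← eLpNorm_congr_ae hae]
  have hn := Lp.norm_fourier_eq (h2.toLp g)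
  rw [Lp.norm_def, Lp.norm_def, ENNReal.toReal_eq_toReal_iff' (Lp.eLpNorm_ne_top _)
    (Lp.eLpNorm_ne_top _)] at hn
  rw [hn, eLpNorm_congr_ae h2.coeFn_toLp]

theorem lintegral_abs_deriv_quadratic_le (A B C : ℝ) (G : ℝ → ℝ≥0∞) :
    ∫⁻ x, ENNReal.ofReal |2 * A * x + B| * G (A * x ^ 2 + B * x + C) ≤ 2 * ∫⁻ y, G y := by
  by_cases h0 : A = 0 ∧ B = 0
  · simp [h0.1, h0.2]
  have hle : ∀ s : Set ℝ, MeasurableSet s → Set.InjOn (fun x => A * x ^ 2 + B * x + C) s →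
      ∫⁻ x in s, ENNReal.ofReal |2 * A * x + B| * G (A * x ^ 2 + B * x + C) ≤ ∫⁻ y, G y := by
    intro s hs hinj
    have hd : ∀ x ∈ s, HasDerivWithinAt (fun x => A * x ^ 2 + B * x + C) (2 * A * x + B) s x := by
      intro x _
      have h := (((hasDerivAt_pow 2 x).const_mul A).add ((hasDerivAt_id x).const_mul B)).add_const C
      refine (h.congr_deriv ?_).hasDerivWithinAt
      simp; ring
    rw [← lintegral_image_eq_lintegral_abs_deriv_mul hs hd hinj]
    exact setLIntegral_le_lintegral _ _
  have hinj : ∀ x y : ℝ, A * x ^ 2 + B * x + C = A * y ^ 2 + B * y + C →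
      x = y ∨ (A ≠ 0 ∧ x + y = 2 * (-B / (2 * A))) := by
    intro x y hxy
    by_cases hA : A = 0
    · left
      have hB : B ≠ 0 := fun h => h0 ⟨hA, h⟩
      apply mul_left_cancel₀ hB
      subst hA; linarith
    · have : (x - y) * (A * (x + y) + B) = 0 := by linear_combination hxy
      rcases mul_eq_zero.1 this with h | h
      · left; linarith
      · right; refine ⟨hA, ?_⟩; field_simp; linarith
  set m := -B / (2 * A)
  rw [← lintegral_add_compl _ (measurableSet_Iic : MeasurableSet (Set.Iic m)),
    two_mul (∫⁻ y, G y)]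
  refine add_le_add (hle _ measurableSet_Iic ?_) (hle _ measurableSet_Iic.compl ?_)
  · intro x hx y hy hxy
    simp only [Set.mem_Iic] at hx hy
    rcases hinj x y hxy with h | h
    · exact h
    · linarith [h.2]
  · intro x hx y hy hxy
    simp only [Set.compl_Iic, Set.mem_Ioi] at hx hy
    rcases hinj x y hxy with h | h
    · exact h
    · linarith [h.2]

theorem lintegral_weight_lt_top {b : ℝ} (hb : 1 / 2 < b) :
    ∫⁻ y : ℝ, ENNReal.ofReal ((1 + y ^ 2) ^ (-b)) < ∞ := by
  have h := integrable_rpow_neg_one_add_norm_sq (E := ℝ) (μ := volume) (r := 2 * b)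
    (by simp; linarith)
  have h' : Integrable (fun y : ℝ => (1 + y ^ 2) ^ (-b)) := by
    refine h.congr (Filter.Eventually.of_forall fun y => ?_)
    simp only [Real.norm_eq_abs, sq_abs]
    congr 1; ring
  exact h'.lintegral_lt_top

theorem lintegral_resonance_le (ν μ ξ : ℝ) {G : ℝ → ℝ≥0∞} (hG : Measurable G) :
    ∫⁻ x, ENNReal.ofReal |dphase ν μ x - dphase ν μ (ξ - x)| *
      G (phase ν μ x + phase ν μ (ξ - x)) ≤ 8 * ∫⁻ y, G y := by
  let A : ℝ → ℝ → ℝ := fun d e => -ν * (d + e) + 3 * μ * ξ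
  let B : ℝ → ℝ := fun e => 2 * ν * e * ξ - 3 * μ * ξ ^ 2
  let C : ℝ → ℝ := fun e => -ν * e * ξ ^ 2 + μ * ξ ^ 3
  let q : ℝ → ℝ → ℝ → ℝ≥0∞ := fun d e x =>
    ENNReal.ofReal |2 * (A d e) * x + B e| * G (A d e * x ^ 2 + B e * x + C e)
  have hq : ∀ d e, Measurable (q d e) := fun d e =>
    (Measurable.ennreal_ofReal (by fun_prop)).mul (hG.comp (by fun_prop))
  have hqi : ∀ d e, ∫⁻ x, q d e x ≤ 2 * ∫⁻ y, G y := fun d e =>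
    lintegral_abs_deriv_quadratic_le _ _ _ G
  have hpt : ∀ d e x : ℝ, |x| = d * x → |ξ - x| = e * (ξ - x) →
      ENNReal.ofReal |dphase ν μ x - dphase ν μ (ξ - x)| *
        G (phase ν μ x + phase ν μ (ξ - x)) = q d e x := by
    intro d e x hd he
    simp only [q, A, B, C, dphase, phase, hd, he]
    congr 2
    · congr 1; ring
    · ring
  calc _ ≤ ∫⁻ x, (q 1 1 x + q 1 (-1) x) + (q (-1) 1 x + q (-1) (-1) x) := by
        refine lintegral_mono fun x => ?_
        rcases abs_choice x with hx | hx <;> rcases abs_choice (ξ - x) with hy | hy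
        · rw [hpt 1 1 x (by simpa using hx) (by simpa using hy)]
          exact le_self_add.trans le_self_add
        · rw [hpt 1 (-1) x (by simpa using hx) (by simpa using hy)]
          exact le_add_self.trans le_self_add
        · rw [hpt (-1) 1 x (by simpa using hx) (by simpa using hy)]
          exact le_self_add.trans le_add_self
        · rw [hpt (-1) (-1) x (by simpa using hx) (by simpa using hy)]
          exact le_add_self.trans le_add_self
    _ ≤ (2 * (∫⁻ y, G y) + 2 * ∫⁻ y, G y) + (2 * (∫⁻ y, G y) + 2 * ∫⁻ y, G y) := by
        rw [lintegral_add_left (by fun_prop), lintegral_add_left (hq _ _),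
          lintegral_add_left (hq _ _)]
        exact add_le_add (add_le_add (hqi _ _) (hqi _ _)) (add_le_add (hqi _ _) (hqi _ _))
    _ = 8 * ∫⁻ y, G y := by ring

theorem continuous_phase (ν μ : ℝ) : Continuous (phase ν μ) := by
  unfold phase; fun_prop

theorem continuous_dphase (ν μ : ℝ) : Continuous (dphase ν μ) := by
  unfold dphase; fun_prop

theorem lintegral_kernel_le (ν μ ξ τ : ℝ) {W : ℝ → ℝ≥0∞} (hW : Measurable W) :
    ∫⁻ p : ℝ × ℝ, ENNReal.ofReal |dphase ν μ p.1 - dphase ν μ (ξ - p.1)| *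
      (W (p.2 - phase ν μ p.1) * W (τ - p.2 - phase ν μ (ξ - p.1))) ≤
      8 * (∫⁻ y, W y) ^ 2 := by
  have hφ := (continuous_phase ν μ).measurable
  have hd := (continuous_dphase ν μ).measurable
  have hm : Measurable fun p : ℝ × ℝ =>
      ENNReal.ofReal |dphase ν μ p.1 - dphase ν μ (ξ - p.1)| *
      (W (p.2 - phase ν μ p.1) * W (τ - p.2 - phase ν μ (ξ - p.1))) := by fun_prop
  have hm' : Measurable fun p : ℝ × ℝ =>
      ENNReal.ofReal |dphase ν μ p.1 - dphase ν μ (ξ - p.1)| *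
      (W p.2 * W (τ - p.2 - (phase ν μ p.1 + phase ν μ (ξ - p.1)))) := by fun_prop
  rw [Measure.volume_eq_prod, lintegral_prod _ hm.aemeasurable]
  calc _ = ∫⁻ x, ∫⁻ s, ENNReal.ofReal |dphase ν μ x - dphase ν μ (ξ - x)| *
        (W s * W (τ - s - (phase ν μ x + phase ν μ (ξ - x)))) := by
        refine lintegral_congr fun x => ?_
        rw [← lintegral_add_right_eq_self _ (phase ν μ x)]
        refine lintegral_congr fun s => ?_
        simp only [add_sub_cancel_right]
        congr 3; ring
    _ = ∫⁻ s, ∫⁻ x, ENNReal.ofReal |dphase ν μ x - dphase ν μ (ξ - x)| *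
        (W s * W (τ - s - (phase ν μ x + phase ν μ (ξ - x)))) :=
        lintegral_lintegral_swap hm'.aemeasurable
    _ ≤ ∫⁻ s, W s * (8 * ∫⁻ y, W y) := by
        refine lintegral_mono fun s => ?_
        have h := lintegral_resonance_le ν μ ξ (G := fun y => W (τ - s - y)) (by fun_prop)
        rw [lintegral_sub_left_eq_self] at h
        refine le_trans (le_of_eq ?_) (mul_le_mul_right h (W s))
        rw [← lintegral_const_mul _ (by fun_prop)]
        exact lintegral_congr fun x => by ring
    _ = _ := by rw [lintegral_mul_const _ hW]; ring

theorem lintegral_sq_le_of_sq_le_mul {α : Type*} [MeasurableSpace α] {m : Measure α}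
    {f A B : α → ℝ≥0∞} (hA : Measurable A) (hB : Measurable B)
    (h : ∀ x, f x ^ 2 ≤ A x * B x) :
    (∫⁻ x, f x ∂m) ^ 2 ≤ (∫⁻ x, A x ∂m) * ∫⁻ x, B x ∂m := by
  have hsq : ∀ x : ℝ≥0∞, (x ^ (1 / 2 : ℝ)) ^ (2 : ℝ) = x := fun x => by
    rw [← ENNReal.rpow_mul]; norm_num
  have hf : ∀ x, f x ≤ A x ^ (1 / 2 : ℝ) * B x ^ (1 / 2 : ℝ) := fun x => by
    rw [← ENNReal.mul_rpow_of_nonneg _ _ (by norm_num), one_div,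
      ENNReal.le_rpow_inv_iff (by norm_num)]
    exact_mod_cast h x
  have hcs := ENNReal.lintegral_mul_le_Lp_mul_Lq m Real.HolderConjugate.two_two
    (hA.pow_const (1 / 2 : ℝ)).aemeasurable (hB.pow_const (1 / 2 : ℝ)).aemeasurable
  simp only [hsq, Pi.mul_apply] at hcs
  calc _ ≤ ((∫⁻ x, A x ∂m) ^ (1 / 2 : ℝ) * (∫⁻ x, B x ∂m) ^ (1 / 2 : ℝ)) ^ 2 := by
        gcongr; exact (lintegral_mono hf).trans hcs
    _ = _ := by
        rw [mul_pow]; simp only [← ENNReal.rpow_natCast, Nat.cast_ofNat, hsq]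

theorem continuous_modulation (ν μ b : ℝ) :
    Continuous fun p : ℝ × ℝ => (1 + (p.2 - phase ν μ p.1) ^ 2) ^ b := by
  have hφ := continuous_phase ν μ
  refine Continuous.rpow_const (by fun_prop) fun p => Or.inl ?_
  positivity

theorem XNorm_zero_sq (ν μ b : ℝ) {u : ℝ → ℝ → ℂ} {S : ℝ × ℝ → ℂ} (hS : Continuous S)
    (h : ∀ ξ τ, FT2 u ξ τ = S (ξ, τ)) :
    XNorm ν μ 0 b u ^ 2 =
      ∫⁻ p : ℝ × ℝ, ENNReal.ofReal ((1 + (p.2 - phase ν μ p.1) ^ 2) ^ b) * ‖S p‖ₑ ^ 2 := by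
  have hm := (continuous_modulation ν μ b).measurable
  have hSm := hS.measurable
  rw [XNorm, ← ENNReal.rpow_natCast, ← ENNReal.rpow_mul, Measure.volume_eq_prod,
    lintegral_prod _ (by fun_prop)]
  simp [h, enorm_eq_nnnorm]

theorem enorm_IsHat_sq_le (ν μ b : ℝ) {u v : ℝ → ℝ → ℂ} {S T : ℝ × ℝ → ℂ}
    (hS : Continuous S) (hT : Continuous T)
    (hu : ∀ ξ τ, FT2 u ξ τ = S (ξ, τ)) (hv : ∀ ξ τ, FT2 v ξ τ = T (ξ, τ)) (z : ℝ × ℝ) :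
    ‖IsHat ν μ (1 / 2) u v z.1 z.2‖ₑ ^ 2 ≤
      8 * (∫⁻ y : ℝ, ENNReal.ofReal ((1 + y ^ 2) ^ (-b))) ^ 2 *
      ∫⁻ p : ℝ × ℝ, (ENNReal.ofReal ((1 + (p.2 - phase ν μ p.1) ^ 2) ^ b) * ‖S p‖ₑ ^ 2) *
        (ENNReal.ofReal ((1 + ((z - p).2 - phase ν μ (z - p).1) ^ 2) ^ b) * ‖T (z - p)‖ₑ ^ 2) := by
  obtain ⟨ξ, τ⟩ := z
  have hφ := (continuous_phase ν μ).measurable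
  have hd := (continuous_dphase ν μ).measurable
  have hm := (continuous_modulation ν μ b).measurable
  have hSm := hS.measurable
  have hTm := hT.measurable
  set W : ℝ → ℝ≥0∞ := fun y => ENNReal.ofReal ((1 + y ^ 2) ^ (-b)) with hW
  have hWm : Measurable W := by fun_prop
  have hW1 : ∀ y : ℝ, W y * ENNReal.ofReal ((1 + y ^ 2) ^ b) = 1 := fun y => by
    rw [hW, ← ENNReal.ofReal_mul (by positivity), ← Real.rpow_add (by positivity)]
    simp
  have hle : ‖IsHat ν μ (1 / 2) u v ξ τ‖ₑ ≤
      ∫⁻ p : ℝ × ℝ, ENNReal.ofReal (|dphase ν μ p.1 - dphase ν μ (ξ - p.1)| ^ (1 / 2 : ℝ)) *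
        (‖S p‖ₑ * ‖T ((ξ, τ) - p)‖ₑ) := by
    rw [Measure.volume_eq_prod, lintegral_prod _ (by fun_prop)]
    refine (enorm_integral_le_lintegral_enorm _).trans (lintegral_mono fun x => ?_)
    refine (enorm_integral_le_lintegral_enorm _).trans (lintegral_mono fun s => ?_)
    rw [enorm_mul, enorm_mul, hu, hv, ← ofReal_norm (Complex.ofReal _),
      Complex.norm_real, Real.norm_of_nonneg (by positivity)]
    rfl
  have hcs := lintegral_sq_le_of_sq_le_mul (m := (volume : Measure (ℝ × ℝ)))
    (f := fun p => ENNReal.ofReal (|dphase ν μ p.1 - dphase ν μ (ξ - p.1)| ^ (1 / 2 : ℝ)) *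
        (‖S p‖ₑ * ‖T ((ξ, τ) - p)‖ₑ))
    (A := fun p => ENNReal.ofReal |dphase ν μ p.1 - dphase ν μ (ξ - p.1)| *
      (W (p.2 - phase ν μ p.1) * W (τ - p.2 - phase ν μ (ξ - p.1))))
    (B := fun p => (ENNReal.ofReal ((1 + (p.2 - phase ν μ p.1) ^ 2) ^ b) * ‖S p‖ₑ ^ 2) *
        (ENNReal.ofReal ((1 + (((ξ, τ) - p).2 - phase ν μ ((ξ, τ) - p).1) ^ 2) ^ b) *
          ‖T ((ξ, τ) - p)‖ₑ ^ 2)) (by fun_prop) (by fun_prop) (by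
      intro p
      have h1 := hW1 (p.2 - phase ν μ p.1)
      have h2 := hW1 (τ - p.2 - phase ν μ (ξ - p.1))
      have h3 : ENNReal.ofReal (|dphase ν μ p.1 - dphase ν μ (ξ - p.1)| ^ (1 / 2 : ℝ)) ^ 2 =
          ENNReal.ofReal |dphase ν μ p.1 - dphase ν μ (ξ - p.1)| := by
        rw [← ENNReal.ofReal_pow (by positivity), ← Real.sqrt_eq_rpow,
          Real.sq_sqrt (abs_nonneg _)]
      rw [mul_pow, h3, mul_pow]
      simp only [Prod.fst_sub, Prod.snd_sub]
      refine le_of_eq ?_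
      calc _ = ENNReal.ofReal |dphase ν μ p.1 - dphase ν μ (ξ - p.1)| *
            (1 * ‖S p‖ₑ ^ 2 * (1 * ‖T ((ξ, τ) - p)‖ₑ ^ 2)) := by ring
        _ = _ := by rw [← h1]; nth_rewrite 2 [h1]; rw [← h2]; ring)
  calc _ ≤ _ := by gcongr
    _ ≤ _ := hcs
    _ ≤ _ := by gcongr; exact lintegral_kernel_le ν μ ξ τ hWm

theorem lintegral_convolution_le {F H : ℝ × ℝ → ℝ≥0∞} (hF : Measurable F) (hH : Measurable H) :
    ∫⁻ z, ∫⁻ p, F p * H (z - p) = (∫⁻ p, F p) * ∫⁻ p, H p := by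
  rw [lintegral_lintegral_swap (by fun_prop)]
  have : ∀ p, ∫⁻ z, F p * H (z - p) = F p * ∫⁻ z, H z := fun p => by
    rw [lintegral_const_mul _ (by fun_prop), lintegral_sub_right_eq_self]
  simp only [this]
  exact lintegral_mul_const _ hF

theorem eLpNorm_IsHat_le (ν μ : ℝ) {b : ℝ} (hb : 1 / 2 < b) {u v : ℝ → ℝ → ℂ}
    {S T : ℝ × ℝ → ℂ} (hS : Continuous S) (hT : Continuous T)
    (hu : ∀ ξ τ, FT2 u ξ τ = S (ξ, τ)) (hv : ∀ ξ τ, FT2 v ξ τ = T (ξ, τ)) :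
    eLpNorm (fun z : ℝ × ℝ => IsHat ν μ (1 / 2) u v z.1 z.2) 2 volume ≤
      3 * (∫⁻ y : ℝ, ENNReal.ofReal ((1 + y ^ 2) ^ (-b))) *
        (XNorm ν μ 0 b u * XNorm ν μ 0 b v) := by
  have hm := (continuous_modulation ν μ b).measurable
  have hSm := hS.measurable
  have hTm := hT.measurable
  have hK := lintegral_weight_lt_top hb
  rw [eLpNorm_eq_lintegral_rpow_enorm_toReal (by norm_num) (by norm_num),
    ENNReal.toReal_ofNat, one_div (2 : ℝ), ENNReal.rpow_inv_le_iff (by norm_num)]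
  simp only [ENNReal.rpow_ofNat]
  rw [← one_div]
  refine (lintegral_mono (enorm_IsHat_sq_le ν μ b hS hT hu hv)).trans ?_
  rw [lintegral_const_mul' _ _ (ENNReal.mul_ne_top (by norm_num) (ENNReal.pow_ne_top hK.ne)),
    lintegral_convolution_le
    (F := fun p : ℝ × ℝ => ENNReal.ofReal ((1 + (p.2 - phase ν μ p.1) ^ 2) ^ b) * ‖S p‖ₑ ^ 2)
    (H := fun p : ℝ × ℝ => ENNReal.ofReal ((1 + (p.2 - phase ν μ p.1) ^ 2) ^ b) * ‖T p‖ₑ ^ 2)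
    (by fun_prop) (by fun_prop), ← XNorm_zero_sq ν μ b hS hu, ← XNorm_zero_sq ν μ b hT hv]
  rw [mul_pow, mul_pow, mul_pow]
  gcongr
  norm_num

theorem FT2_eq_fourier {f : ℝ → ℝ → ℂ} (hf : Integrable (Function.uncurry f)) (ξ τ : ℝ) :
    FT2 f ξ τ = 𝓕 (fun z : ℂ => f z.re z.im) ⟨ξ / (2 * π), τ / (2 * π)⟩ := by
  have hint : Integrable (fun p : ℝ × ℝ =>
      Complex.exp (-(Complex.I * (ξ * p.1 + τ * p.2))) * f p.1 p.2) := by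
    refine hf.bdd_mul (c := 1) (Continuous.aestronglyMeasurable (by fun_prop)) ?_
    refine Filter.Eventually.of_forall fun p => le_of_eq ?_
    rw [Complex.norm_exp]
    simp
  rw [Real.fourier_eq', FT2]
  refine (integral_prod _ hint).symm.trans ?_
  rw [← Measure.volume_eq_prod, ← Complex.volume_preserving_equiv_real_prod.integral_comp
    Complex.measurableEquivRealProd.measurableEmbedding]
  refine integral_congr_ae (Filter.Eventually.of_forall fun z => ?_)
  simp only [Complex.measurableEquivRealProd_apply, smul_eq_mul, Complex.inner]
  congr 2
  simp
  have : (π : ℂ) ≠ 0 := by exact_mod_cast pi_ne_zero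
  field_simp

theorem exists_schwartz_FT2 (u : SchwartzMap (ℝ × ℝ) ℂ) :
    ∃ S : SchwartzMap (ℝ × ℝ) ℂ, ∀ ξ τ, FT2 (fun x t => u (x, t)) ξ τ = S (ξ, τ) := by
  let e : ℂ ≃L[ℝ] ℝ × ℝ := Complex.equivRealProdCLM
  let U : SchwartzMap ℂ ℂ := SchwartzMap.compCLMOfContinuousLinearEquiv ℂ e u
  let d : (ℝ × ℝ) ≃L[ℝ] ℂ := (ContinuousLinearEquiv.smulLeft
    (Units.mk0 (2 * π)⁻¹ (by positivity) : ℝˣ)).trans e.symm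
  refine ⟨SchwartzMap.compCLMOfContinuousLinearEquiv ℂ d (𝓕 U), fun ξ τ => ?_⟩
  rw [FT2_eq_fourier (f := fun x t => u (x, t)) u.integrable]
  change _ = (𝓕 U) (d (ξ, τ))
  rw [SchwartzMap.fourier_coe]
  refine congrArg (𝓕 (fun z : ℂ => u (z.re, z.im))) ?_
  apply Complex.ext
  · change ξ / (2 * π) = (2 * π)⁻¹ * ξ
    ring
  · change τ / (2 * π) = (2 * π)⁻¹ * τ
    ring

theorem eLpNorm_comp_smul_complex {g : ℂ → ℂ} (hg : AEStronglyMeasurable g volume) {r : ℝ}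
    (hr : r ≠ 0) :
    eLpNorm (fun w => g (r • w)) 2 volume = ENNReal.ofReal |r|⁻¹ * eLpNorm g 2 volume := by
  have hmap := Measure.map_addHaar_smul (volume : Measure ℂ) hr
  have hg' : AEStronglyMeasurable g (Measure.map (fun w : ℂ => r • w) volume) := by
    rw [hmap]
    exact hg.smul_measure _
  have h := eLpNorm_map_measure (p := 2) hg' (Measurable.aemeasurable (by fun_prop))
  rw [hmap, eLpNorm_smul_measure_of_ne_top (by norm_num)] at h
  refine h.symm.trans ?_
  rw [Complex.finrank_real_complex, smul_eq_mul]
  congr 1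
  rw [ENNReal.ofReal_rpow_of_nonneg (abs_nonneg _) (by norm_num)]
  congr 1
  simp only [ENNReal.toReal_div, ENNReal.toReal_one, ENNReal.toReal_ofNat]
  rw [← Real.sqrt_eq_rpow, abs_inv, abs_pow, Real.sqrt_inv, Real.sqrt_sq (abs_nonneg _)]

theorem eLpNorm_FT2_neg_le {f : ℝ → ℝ → ℂ} (hf : Integrable (Function.uncurry f)) :
    eLpNorm (fun z : ℝ × ℝ => FT2 f (-z.1) (-z.2)) 2 volume ≤
      ENNReal.ofReal (2 * π) * eLpNorm (fun z : ℝ × ℝ => f z.1 z.2) 2 volume := by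
  obtain ⟨g, hgdef⟩ : ∃ g : ℂ → ℂ, g = fun z => f z.re z.im := ⟨_, rfl⟩
  have hmp := Complex.volume_preserving_equiv_real_prod
  have hg : Integrable g := by
    rw [hgdef]
    exact (hmp.integrable_comp_emb Complex.measurableEquivRealProd.measurableEmbedding).2 hf
  have hcont : Continuous (𝓕 g) :=
    VectorFourier.fourierIntegral_continuous Real.continuous_fourierChar continuous_inner hg
  have hr : (-(2 * π)⁻¹ : ℝ) ≠ 0 := neg_ne_zero.2 (by positivity)
  have hg2 : eLpNorm g 2 volume = eLpNorm (fun z : ℝ × ℝ => f z.1 z.2) 2 volume := by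
    have hf1 : AEStronglyMeasurable (fun z : ℝ × ℝ => f z.1 z.2) volume := hf.1
    rw [← eLpNorm_comp_measurePreserving hf1 hmp, hgdef]
    rfl
  have hFT : (fun z : ℝ × ℝ => FT2 f (-z.1) (-z.2)) =
      (fun w : ℂ => 𝓕 g ((-(2 * π)⁻¹ : ℝ) • w)) ∘ Complex.measurableEquivRealProd.symm := by
    ext z
    rw [FT2_eq_fourier hf, ← hgdef]
    simp only [Function.comp]
    refine congrArg (𝓕 g) ?_
    apply Complex.ext
    · simp; ring
    · simp; ring
  have hm : AEStronglyMeasurable (fun w : ℂ => 𝓕 g ((-(2 * π)⁻¹ : ℝ) • w)) volume :=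
    (hcont.comp (continuous_const_smul _)).aestronglyMeasurable
  rw [hFT, eLpNorm_comp_measurePreserving hm hmp.symm,
    eLpNorm_comp_smul_complex hcont.aestronglyMeasurable hr, ← hg2, abs_neg, abs_inv, inv_inv,
    abs_of_nonneg (by positivity)]
  gcongr
  exact eLpNorm_fourier_le hg

theorem rpow_half_abs_dphase_sub_le (ν μ x y : ℝ) :
    |dphase ν μ x - dphase ν μ y| ^ (1 / 2 : ℝ) ≤
      (1 + 2 * (2 * |ν| + 3 * |μ|)) * ((1 + x ^ 2) * (1 + y ^ 2)) := by
  set M := 2 * |ν| + 3 * |μ| with hM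
  have hM0 : 0 ≤ M := by positivity
  have hd : ∀ x, |dphase ν μ x| ≤ M * (1 + x ^ 2) := fun x => by
    have h1 : |dphase ν μ x| ≤ 2 * |ν| * |x| + 3 * |μ| * x ^ 2 := by
      refine (abs_add_le _ _).trans (le_of_eq ?_)
      simp [abs_mul]
    have h2 : |x| ≤ 1 + x ^ 2 := by nlinarith [sq_abs x, sq_nonneg (|x| - 1)]
    rw [hM]
    nlinarith [abs_nonneg ν, abs_nonneg μ, mul_le_mul_of_nonneg_left h2 (abs_nonneg ν)]
  have h1 : |dphase ν μ x - dphase ν μ y| ≤ M * (1 + x ^ 2) + M * (1 + y ^ 2) :=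
    (abs_sub _ _).trans (add_le_add (hd x) (hd y))
  have h2 : |dphase ν μ x - dphase ν μ y| ^ (1 / 2 : ℝ) ≤
      1 + |dphase ν μ x - dphase ν μ y| := by
    rw [← Real.sqrt_eq_rpow]
    refine Real.sqrt_le_iff.2 ⟨by positivity, ?_⟩
    nlinarith [abs_nonneg (dphase ν μ x - dphase ν μ y)]
  have hx : 0 ≤ x ^ 2 := sq_nonneg x
  have hy : 0 ≤ y ^ 2 := sq_nonneg y
  have hxy := mul_nonneg hx hy
  nlinarith [mul_nonneg hM0 hx, mul_nonneg hM0 hy, mul_nonneg hM0 hxy]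

theorem SchwartzMap.integrable_one_add_fst_sq_mul (S : SchwartzMap (ℝ × ℝ) ℂ) :
    Integrable fun p : ℝ × ℝ => (1 + p.1 ^ 2) * ‖S p‖ := by
  have h := S.integrable.norm.add (S.integrable_pow_mul volume 2)
  refine h.mono' (Continuous.aestronglyMeasurable (by fun_prop))
    (Filter.Eventually.of_forall fun p => ?_)
  rw [Real.norm_of_nonneg (by positivity)]
  have hp : p.1 ^ 2 ≤ ‖p‖ ^ 2 := by
    rw [← sq_abs, ← Real.norm_eq_abs]
    gcongr
    exact norm_fst_le p
  have := mul_le_mul_of_nonneg_right hp (norm_nonneg (S p))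
  simp only [Pi.add_apply]
  linarith

theorem integrable_IsHat (ν μ : ℝ) {u v : ℝ → ℝ → ℂ} {S T : SchwartzMap (ℝ × ℝ) ℂ}
    (hu : ∀ ξ τ, FT2 u ξ τ = S (ξ, τ)) (hv : ∀ ξ τ, FT2 v ξ τ = T (ξ, τ)) :
    Integrable (Function.uncurry (IsHat ν μ (1 / 2) u v)) := by
  have hd := continuous_dphase ν μ
  let k : (ℝ × ℝ) × (ℝ × ℝ) → ℂ := fun q =>
    (↑(|dphase ν μ q.2.1 - dphase ν μ (q.1.1 - q.2.1)| ^ (1 / 2 : ℝ)) : ℂ) *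
      (S q.2 * T (q.1 - q.2))
  have hkc : Continuous k := by
    have : Continuous fun q : (ℝ × ℝ) × (ℝ × ℝ) =>
        |dphase ν μ q.2.1 - dphase ν μ (q.1.1 - q.2.1)| ^ (1 / 2 : ℝ) :=
      Continuous.rpow_const (by fun_prop) fun _ => Or.inr (by norm_num)
    fun_prop
  have hk : Integrable k ((volume : Measure (ℝ × ℝ)).prod volume) := by
    have h := (S.integrable_one_add_fst_sq_mul.convolution_integrand (ContinuousLinearMap.mul ℝ ℝ)
      T.integrable_one_add_fst_sq_mul).const_mul (1 + 2 * (2 * |ν| + 3 * |μ|))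
    refine h.mono' hkc.aestronglyMeasurable (Filter.Eventually.of_forall fun q => ?_)
    simp only [k, norm_mul, Complex.norm_real, ContinuousLinearMap.mul_apply', Prod.fst_sub]
    rw [Real.norm_of_nonneg (by positivity)]
    refine (mul_le_mul_of_nonneg_right (rpow_half_abs_dphase_sub_le ν μ _ _)
      (by positivity)).trans (le_of_eq ?_)
    ring
  refine hk.integral_prod_left.congr ?_
  filter_upwards [hk.prod_right_ae] with z hz
  refine (integral_prod _ hz).trans ?_
  simp only [Function.uncurry, IsHat, hu, hv]
  rfl

/-- **Lemma 2.5** (bilinear refinement estimate): for every `b > 1/2` there is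
`C > 0`, depending only on `ν, μ, b`, such that
`‖I^{1/2}(u,v)‖_{L²(ℝ²)} ≤ C ‖u‖_{X_{0,b}} ‖v‖_{X_{0,b}}` for all Schwartz `u, v`. -/
theorem benjamin_bilinear_refinement (ν μ : ℝ) (hμ : μ ≠ 0) (b : ℝ) (hb : 1 / 2 < b) :
    ∃ C > (0 : ℝ), ∀ u v : SchwartzMap (ℝ × ℝ) ℂ,
      eLpNorm
          (fun z : ℝ × ℝ =>
            IsOp ν μ (1 / 2) (fun x t => u (x, t)) (fun x t => v (x, t)) z.1 z.2) 2
          (volume : Measure (ℝ × ℝ)) ≤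
        ENNReal.ofReal C *
          (XNorm ν μ 0 b (fun x t => u (x, t)) * XNorm ν μ 0 b (fun x t => v (x, t))) := by
  have hK := (lintegral_weight_lt_top hb).ne
  set K := ∫⁻ y : ℝ, ENNReal.ofReal ((1 + y ^ 2) ^ (-b))
  have hc : ‖(((2 * π) ^ 2)⁻¹ : ℝ)‖ₑ * (ENNReal.ofReal (2 * π) * (3 * K)) ≠ ∞ :=
    ENNReal.mul_ne_top enorm_ne_top (ENNReal.mul_ne_top ENNReal.ofReal_ne_top
      (ENNReal.mul_ne_top (by norm_num) hK))
  refine ⟨(‖(((2 * π) ^ 2)⁻¹ : ℝ)‖ₑ * (ENNReal.ofReal (2 * π) * (3 * K))).toReal + 1,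
    by positivity, fun u v => ?_⟩
  obtain ⟨S, hu⟩ := exists_schwartz_FT2 u
  obtain ⟨T, hv⟩ := exists_schwartz_FT2 v
  have hop : (fun z : ℝ × ℝ =>
      IsOp ν μ (1 / 2) (fun x t => u (x, t)) (fun x t => v (x, t)) z.1 z.2) =
      (((2 * π) ^ 2)⁻¹ : ℝ) • fun z : ℝ × ℝ =>
        FT2 (IsHat ν μ (1 / 2) (fun x t => u (x, t)) (fun x t => v (x, t))) (-z.1) (-z.2) := by
    ext z
    simp only [Pi.smul_apply, IsOp, FT2]
    congr 1
    refine integral_congr_ae (Filter.Eventually.of_forall fun ξ => ?_)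
    refine integral_congr_ae (Filter.Eventually.of_forall fun τ => ?_)
    simp only
    congr 2
    push_cast
    ring
  rw [hop, eLpNorm_const_smul]
  calc _ ≤ ‖(((2 * π) ^ 2)⁻¹ : ℝ)‖ₑ * (ENNReal.ofReal (2 * π) * (3 * K *
        (XNorm ν μ 0 b (fun x t => u (x, t)) * XNorm ν μ 0 b (fun x t => v (x, t))))) := by
        gcongr
        refine (eLpNorm_FT2_neg_le (integrable_IsHat ν μ hu hv)).trans ?_
        gcongr
        exact eLpNorm_IsHat_le ν μ hb S.continuous T.continuous hu hv
    _ = ‖(((2 * π) ^ 2)⁻¹ : ℝ)‖ₑ * (ENNReal.ofReal (2 * π) * (3 * K)) *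
        (XNorm ν μ 0 b (fun x t => u (x, t)) * XNorm ν μ 0 b (fun x t => v (x, t))) := by ring
    _ ≤ _ := by
        gcongr
        exact (ENNReal.ofReal_toReal hc).symm.le.trans
          (ENNReal.ofReal_le_ofReal (le_add_of_nonneg_right zero_le_one))
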